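/- arXiv:2504.06711 — 2 statements merged into one kernel-verified Lean document; each statement's English description precedes it below -/
import Mathlib

section
/- Let 1 ≤ k ≤ n and λ = (λ_1,…,λ_n) ∈ Γ_k with λ_1 ≥ λ_2 ≥ ⋯ ≥ λ_n. If λ_i ≤ 0 for some index i, then −λ_i ≤ ((n−k)/k)·λ_1. -/
open Finset

/-- The `j`-th elementary symmetric polynomial of `lam` restricted to the index set `A`,
with `σ_0 = 1` and `σ_j = 0` for `j < 0` or `j > |A|`. -/
noncomputable def esigma {n : ℕ} (A : Finset (Fin n)) (j : ℤ) (lam : Fin n → ℝ) : ℝ :=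
  if 0 ≤ j then ∑ s ∈ A.powersetCard j.toNat, ∏ i ∈ s, lam i else 0

/-- The sum Hessian operator `S_j(λ) = σ_{j-1}(λ) + α σ_j(λ)` on the index set `A`. -/
noncomputable def Ssum {n : ℕ} (α : ℝ) (A : Finset (Fin n)) (j : ℤ) (lam : Fin n → ℝ) : ℝ :=
  esigma A (j - 1) lam + α * esigma A j lam

/-- The Gårding cone `Γ_k`. -/
def Gamma (n k : ℕ) : Set (Fin n → ℝ) :=
  {lam | ∀ j : ℕ, 1 ≤ j → j ≤ k → 0 < esigma Finset.univ (j : ℤ) lam}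

/-- The admissible cone `Γ̃_k = Γ_{k-1} ∩ {S_k > 0}`. -/
def GammaTilde (n k : ℕ) (α : ℝ) : Set (Fin n → ℝ) :=
  Gamma n (k - 1) ∩ {lam | 0 < Ssum α Finset.univ (k : ℤ) lam}

namespace Polynomial

/-- By Rolle's theorem, the derivative of a real-rooted polynomial is real-rooted. -/
theorem Splits.derivative_real {p : ℝ[X]} (hp : p.Splits) : (derivative p).Splits := by
  rw [splits_iff_card_roots] at hp ⊢
  have h1 := card_roots_le_derivative p
  have h2 := card_roots' (derivative p)
  have h3 := natDegree_derivative_le p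
  omega

theorem Splits.iterate_derivative_real {p : ℝ[X]} (hp : p.Splits) (m : ℕ) :
    (derivative^[m] p).Splits := by
  induction m with
  | zero => exact hp
  | succ m ih =>
    rw [Function.iterate_succ_apply']
    exact ih.derivative_real

/-- The Laguerre inequality `p p'' ≤ (p')²` for real-rooted polynomials. -/
theorem Splits.eval_mul_eval_derivative_derivative_le {p : ℝ[X]} (hp : p.Splits) (x : ℝ) :
    p.eval x * (derivative (derivative p)).eval x ≤ (derivative p).eval x ^ 2 := by
  induction hp using Submonoid.closure_induction with
  | mem p hp =>
    rcases hp with ⟨a, rfl⟩ | ⟨a, rfl⟩ <;> simp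
  | one => simp
  | mul p q _ _ hp hq =>
    simp only [derivative_mul, derivative_add, eval_add, eval_mul]
    nlinarith [mul_le_mul_of_nonneg_left hp (sq_nonneg (q.eval x)),
      mul_le_mul_of_nonneg_left hq (sq_nonneg (p.eval x))]

end Polynomial

namespace Multiset

open Polynomial in
/-- A weak form of Newton's inequality: the elementary symmetric functions of real numbers
form a log-concave sequence. -/
theorem esymm_mul_esymm_le_sq (s : Multiset ℝ) (j : ℕ) :
    s.esymm j * s.esymm (j + 2) ≤ s.esymm (j + 1) ^ 2 := by
  rcases lt_or_ge (card s) (j + 2) with hlt | hle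
  · have h0 : s.esymm (j + 2) = 0 := by
      simp [esymm, powersetCard_eq_empty _ hlt]
    rw [h0, mul_zero]
    positivity
  obtain ⟨d, hd⟩ := Nat.exists_eq_add_of_le hle
  set p : ℝ[X] := (s.map fun r => X + C r).prod with hp
  have hsplit : p.Splits := by
    refine Splits.multisetProd fun f hf => ?_
    obtain ⟨a, -, rfl⟩ := mem_map.1 hf
    exact Splits.X_add_C a
  have key := (hsplit.iterate_derivative_real d).eval_mul_eval_derivative_derivative_le 0
  rw [← Function.iterate_succ_apply' (⇑derivative), ← Function.iterate_succ_apply' (⇑derivative),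
    ← coeff_zero_eq_eval_zero, ← coeff_zero_eq_eval_zero, ← coeff_zero_eq_eval_zero,
    coeff_iterate_derivative, coeff_iterate_derivative, coeff_iterate_derivative,
    zero_add, zero_add, zero_add, hp, prod_X_add_C_coeff _ (by omega),
    prod_X_add_C_coeff _ (by omega), prod_X_add_C_coeff _ (by omega),
    Nat.descFactorial_self, Nat.descFactorial_self, Nat.descFactorial_self,
    show card s - d = j + 2 by omega, show card s - d.succ = j + 1 by omega,
    show card s - d.succ.succ = j by omega, Nat.factorial_succ (d + 1), Nat.factorial_succ d] at key
  simp only [nsmul_eq_mul, Nat.cast_mul, Nat.cast_add, Nat.cast_one] at key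
  have hf : (0 : ℝ) < (d.factorial : ℝ) ^ 2 * (d + 1) := by positivity
  have hd0 : (0 : ℝ) ≤ d := d.cast_nonneg
  have key' : (d + 2) * (s.esymm j * s.esymm (j + 2)) ≤ (d + 1) * s.esymm (j + 1) ^ 2 := by
    refine le_of_mul_le_mul_left ?_ hf
    linarith
  nlinarith [sq_nonneg (s.esymm (j + 1))]

theorem esymm_cons_succ {R : Type*} [CommSemiring R] (a : R) (s : Multiset R) (j : ℕ) :
    (a ::ₘ s).esymm (j + 1) = s.esymm (j + 1) + a * s.esymm j := by
  simp [esymm, powersetCard_cons, Multiset.sum_map_mul_left]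

theorem esymm_zero_right {R : Type*} [CommSemiring R] (s : Multiset R) : s.esymm 0 = 1 := by
  simp [esymm]

/-- Deleting an entry from a vector of the Gårding cone `Γ_{k+1}` leaves a vector of `Γ_k`. -/
theorem esymm_pos_of_cons {a : ℝ} {s : Multiset ℝ} {k : ℕ}
    (h : ∀ j ≤ k + 1, 0 < (a ::ₘ s).esymm j) {j : ℕ} (hj : j ≤ k) : 0 < s.esymm j := by
  induction j with
  | zero => simp [esymm_zero_right]
  | succ j ih =>
    have hpos := ih (by omega)
    by_contra! hneg
    have h1 := h (j + 1) (by omega)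
    have h2 := h (j + 2) (by omega)
    rw [esymm_cons_succ] at h1 h2
    nlinarith [esymm_mul_esymm_le_sq s j]

/-- Deleting a nonpositive entry from a vector of the Gårding cone `Γ_k` leaves a vector
of `Γ_k`. -/
theorem esymm_pos_of_cons_of_nonpos {a : ℝ} (ha : a ≤ 0) {s : Multiset ℝ} {k : ℕ}
    (h : ∀ j ≤ k, 0 < (a ::ₘ s).esymm j) {j : ℕ} (hj : j ≤ k) : 0 < s.esymm j := by
  induction j with
  | zero => simp [esymm_zero_right]
  | succ j ih =>
    have h1 := h (j + 1) hj
    rw [esymm_cons_succ] at h1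
    nlinarith [ih (by omega)]

end Multiset

namespace Finset

variable {ι : Type*} [DecidableEq ι]

theorem map_val_eq_cons_erase {β : Type*} (f : ι → β) {A : Finset ι} {i : ι} (hi : i ∈ A) :
    A.val.map f = f i ::ₘ (A.erase i).val.map f := by
  rw [erase_val, ← Multiset.map_cons, Multiset.cons_erase hi]

theorem sum_esymm_erase {R : Type*} [CommRing R] (f : ι → R) (A : Finset ι) (j : ℕ) :
    ∑ i ∈ A, ((A.erase i).val.map f).esymm j = ((#A : R) - j) * (A.val.map f).esymm j := by
  simp only [esymm_map_val]
  rw [sum_comm' (t' := A.powersetCard j) (s' := fun t => A \ t), mul_sum]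
  · refine sum_congr rfl fun t ht => ?_
    obtain ⟨hsub, hcard⟩ := mem_powersetCard.1 ht
    rw [sum_const, nsmul_eq_mul, cast_card_sdiff hsub, hcard]
  · intro i t
    simp only [mem_powersetCard, mem_sdiff, subset_erase]
    tauto

/-- If deleting any entry keeps `σ_k` nonnegative, then `σ_{k+1}` is controlled by `σ_k` and
an upper bound for the entries. -/
theorem succ_mul_esymm_succ_le {f : ι → ℝ} {A : Finset ι} {k : ℕ} {M : ℝ}
    (hM : ∀ i ∈ A, f i ≤ M) (h : ∀ i ∈ A, 0 ≤ ((A.erase i).val.map f).esymm k) :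
    ((k : ℝ) + 1) * (A.val.map f).esymm (k + 1) ≤ M * ((#A - k) * (A.val.map f).esymm k) := by
  have hsum : ∑ i ∈ A, f i * ((A.erase i).val.map f).esymm k =
      (k + 1) * (A.val.map f).esymm (k + 1) := by
    have hrec : ∑ i ∈ A, f i * ((A.erase i).val.map f).esymm k =
        ∑ i ∈ A, ((A.val.map f).esymm (k + 1) - ((A.erase i).val.map f).esymm (k + 1)) := by
      refine sum_congr rfl fun i hi => ?_
      rw [map_val_eq_cons_erase f hi, Multiset.esymm_cons_succ]
      ring
    rw [hrec, sum_sub_distrib, sum_esymm_erase, sum_const, nsmul_eq_mul]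
    push_cast
    ring
  rw [← hsum, ← sum_esymm_erase, mul_sum]
  exact sum_le_sum fun i hi => mul_le_mul_of_nonneg_right (hM i hi) (h i hi)

end Finset

theorem esigma_natCast {n : ℕ} (A : Finset (Fin n)) (j : ℕ) (lam : Fin n → ℝ) :
    esigma A (j : ℤ) lam = (A.val.map lam).esymm j := by
  simp [esigma, Finset.esymm_map_val]

/-- Lemma 2.2 (iv): for ordered `λ ∈ Γ_k`, if `λ_i ≤ 0` then
`-λ_i ≤ ((n-k)/k) λ_1`. -/
theorem neg_eigenvalue_bound {n k : ℕ} (hk1 : 1 ≤ k) (hkn : k ≤ n)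
    (lam : Fin n → ℝ) (hlam : lam ∈ Gamma n k) (hord : Antitone lam)
    (i : Fin n) (hi : lam i ≤ 0) :
    -lam i ≤ (((n : ℝ) - (k : ℝ)) / (k : ℝ)) * lam ⟨0, by omega⟩ := by
  obtain ⟨k, rfl⟩ := Nat.exists_eq_add_of_le' hk1
  set B : Finset (Fin n) := univ.erase i with hB
  have hpos : ∀ j ≤ k + 1, 0 < (lam i ::ₘ B.val.map lam).esymm j := by
    intro j hj
    rw [← map_val_eq_cons_erase lam (mem_univ i), ← esigma_natCast]
    rcases Nat.eq_zero_or_pos j with rfl | hj0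
    · simp [esigma]
    · exact hlam j hj0 hj
  have hBpos : ∀ j ≤ k + 1, 0 < (B.val.map lam).esymm j := fun j hj =>
    Multiset.esymm_pos_of_cons_of_nonpos hi hpos hj
  have hcard : (#B : ℝ) = n - 1 := by
    rw [hB, card_erase_of_mem (mem_univ i), card_univ, Fintype.card_fin,
      Nat.cast_pred (by omega)]
  have hbound := succ_mul_esymm_succ_le (f := lam) (A := B) (k := k) (M := lam ⟨0, by omega⟩)
    (fun l _ => hord (Fin.mk_le_of_le_val (Nat.zero_le _))) (fun l hl => by
      rw [map_val_eq_cons_erase lam hl] at hBpos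
      exact (Multiset.esymm_pos_of_cons hBpos le_rfl).le)
  have hk := hpos (k + 1) le_rfl
  rw [Multiset.esymm_cons_succ] at hk
  have hσ := hBpos k (by omega)
  rw [hcard] at hbound
  have hk0 : (0 : ℝ) < (k : ℝ) + 1 := by positivity
  push_cast
  rw [div_mul_eq_mul_div, le_div_iff₀ hk0]
  refine le_of_mul_le_mul_right ?_ hσ
  nlinarith
end

section
/- Let 1 ≤ k ≤ n and λ = (λ_1,…,λ_n) ∈ Γ_k with λ_1 ≥ λ_2 ≥ ⋯ ≥ λ_n. Then λ_k + λ_{k+1} + ⋯ + λ_n > 0, and for every index i > k one has |λ_i| ≤ n·λ_k. -/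
open Finset

open Polynomial in
/-- The derivative of a real-rooted polynomial is real-rooted. -/
theorem Polynomial.Splits.derivative_real_s8 {p : ℝ[X]} (hp : p.Splits) :
    (derivative p).Splits := by
  rw [splits_iff_card_roots] at hp ⊢
  have hrolle := card_roots_le_derivative p
  have hdeg := natDegree_derivative_le p
  have hcard := card_roots' (derivative p)
  omega

open Polynomial in
/-- **Laguerre's inequality** for real-rooted polynomials. -/
theorem Polynomial.Splits.eval_mul_eval_derivative_derivative_le_s8 {p : ℝ[X]} (hp : p.Splits)
    (x : ℝ) :
    p.eval x * (derivative (derivative p)).eval x ≤ (derivative p).eval x ^ 2 := by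
  obtain ⟨m, hm⟩ := splits_iff_exists_multiset'.1 hp
  have key : ∀ m : Multiset ℝ, ∀ c : ℝ, ∀ p : ℝ[X], p = C c * (m.map (X + C ·)).prod →
      p.eval x * (derivative (derivative p)).eval x ≤ (derivative p).eval x ^ 2 := by
    intro m c
    induction m using Multiset.induction with
    | empty => rintro p rfl; simp
    | cons a m ih =>
      rintro p rfl
      have hq := ih _ rfl
      generalize hqdef : C c * (m.map (X + C ·)).prod = q at hq
      have hp : C c * ((a ::ₘ m).map (X + C ·)).prod = (X + C a) * q := by
        rw [← hqdef, Multiset.map_cons, Multiset.prod_cons]; ring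
      rw [hp]
      simp only [derivative_mul, derivative_add, derivative_X, derivative_C, add_zero, one_mul,
        eval_add, eval_mul, eval_X, eval_C]
      nlinarith [mul_nonneg (sq_nonneg (x + a)) (sub_nonneg.2 hq), sq_nonneg (q.eval x)]
  exact key m _ p hm

open Polynomial in
/-- **Newton's inequality** for the coefficients of a real-rooted polynomial. -/
theorem Polynomial.Splits.newton_coeff {p : ℝ[X]} (hp : p.Splits) (m : ℕ) :
    (m + 2) * (p.coeff m * p.coeff (m + 2)) ≤ (m + 1) * p.coeff (m + 1) ^ 2 := by
  induction m generalizing p with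
  | zero =>
    have h := hp.eval_mul_eval_derivative_derivative_le_s8 0
    simp only [← coeff_zero_eq_eval_zero, coeff_derivative] at h
    norm_num at h ⊢
    linarith
  | succ m ih =>
    have h := ih hp.derivative_real_s8
    simp only [coeff_derivative] at h
    push_cast at h ⊢
    have hpos : (0 : ℝ) < (m + 1) * (m + 2) := by positivity
    refine le_of_mul_le_mul_left ?_ hpos
    linarith

/-- Log-concavity of the elementary symmetric polynomials at real arguments. -/
theorem Finset.esymm_mul_esymm_le_sq {ι : Type*} (A : Finset ι) (f : ι → ℝ) (j : ℕ) :
    (∑ s ∈ A.powersetCard j, ∏ i ∈ s, f i) * (∑ s ∈ A.powersetCard (j + 2), ∏ i ∈ s, f i) ≤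
      (∑ s ∈ A.powersetCard (j + 1), ∏ i ∈ s, f i) ^ 2 := by
  rcases lt_or_ge #A (j + 2) with hA | hA
  · rw [Finset.powersetCard_eq_empty.2 hA, Finset.sum_empty, mul_zero]
    positivity
  obtain ⟨m, hm⟩ := Nat.exists_eq_add_of_le hA
  have hs : (∏ i ∈ A, (Polynomial.X + Polynomial.C (f i))).Splits :=
    Polynomial.Splits.prod fun i _ => Polynomial.Splits.X_add_C _
  have h := hs.newton_coeff m
  rw [Finset.prod_X_add_C_coeff A f (by omega), Finset.prod_X_add_C_coeff A f (by omega),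
    Finset.prod_X_add_C_coeff A f (by omega), show #A - m = j + 2 by omega,
    show #A - (m + 1) = j + 1 by omega, show #A - (m + 2) = j by omega] at h
  have hm0 : (0 : ℝ) ≤ m := Nat.cast_nonneg m
  generalize (∑ s ∈ A.powersetCard j, ∏ i ∈ s, f i) = a at *
  generalize (∑ s ∈ A.powersetCard (j + 1), ∏ i ∈ s, f i) = b at *
  generalize (∑ s ∈ A.powersetCard (j + 2), ∏ i ∈ s, f i) = c at *
  rcases le_or_gt (a * c) 0 with hac | hac
  · exact hac.trans (sq_nonneg b)
  · refine le_of_mul_le_mul_left (a := (m + 1 : ℝ)) ?_ (by positivity)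
    linarith

theorem Finset.esymm_insert_succ {ι : Type*} [DecidableEq ι] {A : Finset ι} {a : ι} (ha : a ∉ A)
    (f : ι → ℝ) (j : ℕ) :
    ∑ s ∈ (insert a A).powersetCard (j + 1), ∏ i ∈ s, f i =
      ∑ s ∈ A.powersetCard (j + 1), ∏ i ∈ s, f i +
        f a * ∑ s ∈ A.powersetCard j, ∏ i ∈ s, f i := by
  have hmem : ∀ s ∈ A.powersetCard j, a ∉ s := fun s hs h =>
    ha ((Finset.mem_powersetCard.1 hs).1 h)
  rw [Finset.powersetCard_succ_insert ha, Finset.sum_union, Finset.sum_image, Finset.mul_sum]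
  · congr 1
    exact Finset.sum_congr rfl fun s hs => Finset.prod_insert (hmem s hs)
  · intro s hs t ht hst
    rw [← Finset.erase_insert (hmem s hs), ← Finset.erase_insert (hmem t ht), hst]
  · rw [Finset.disjoint_left]
    intro s hs hs'
    obtain ⟨t, -, rfl⟩ := Finset.mem_image.1 hs'
    exact ha ((Finset.mem_powersetCard.1 hs).1 (Finset.mem_insert_self a t))

/-- Deleting one entry from a vector of `Γ_{k+1}` yields a vector of `Γ_k`. -/
theorem Finset.esymm_pos_of_insert {ι : Type*} [DecidableEq ι] {A : Finset ι} {a : ι}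
    (ha : a ∉ A) (f : ι → ℝ) {k : ℕ}
    (h : ∀ j ≤ k + 1, 0 < ∑ s ∈ (insert a A).powersetCard j, ∏ i ∈ s, f i) :
    ∀ j ≤ k, 0 < ∑ s ∈ A.powersetCard j, ∏ i ∈ s, f i := by
  intro j
  induction j with
  | zero => intro _; simp
  | succ j ih =>
    intro hj
    have hprev := ih (by omega)
    have h1 := h (j + 1) (by omega)
    have h2 := h (j + 2) (by omega)
    rw [Finset.esymm_insert_succ ha] at h1 h2
    have hnewton := Finset.esymm_mul_esymm_le_sq A f j
    generalize (∑ s ∈ A.powersetCard j, ∏ i ∈ s, f i) = u at *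
    generalize (∑ s ∈ A.powersetCard (j + 1), ∏ i ∈ s, f i) = v at *
    generalize (∑ s ∈ A.powersetCard (j + 2), ∏ i ∈ s, f i) = w at *
    by_contra! hv
    nlinarith [mul_pos hprev h2, mul_nonneg (neg_nonneg.2 hv) h1.le]

/-- Deleting `#B` entries from a vector of `Γ_{k + #B}` yields a vector of `Γ_k`. -/
theorem Finset.esymm_pos_of_union {ι : Type*} [DecidableEq ι] {A B : Finset ι}
    (hAB : Disjoint B A) (f : ι → ℝ) {k : ℕ}
    (h : ∀ j ≤ k + #B, 0 < ∑ s ∈ (B ∪ A).powersetCard j, ∏ i ∈ s, f i) :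
    ∀ j ≤ k, 0 < ∑ s ∈ A.powersetCard j, ∏ i ∈ s, f i := by
  induction B using Finset.induction generalizing k with
  | empty => simpa using h
  | insert b B hb ih =>
    rw [Finset.disjoint_insert_left] at hAB
    rw [Finset.card_insert_of_notMem hb, Finset.insert_union] at h
    refine ih hAB.2 (Finset.esymm_pos_of_insert ?_ f (k := k + #B) h)
    simp [hb, hAB.1]

/-- Lemma 2.2 (v): for ordered `λ ∈ Γ_k`, `λ_k + λ_{k+1} + ⋯ + λ_n > 0`
and `|λ_i| ≤ n λ_k` for all `i > k`. -/
theorem tail_sum_pos_and_abs_bound {n k : ℕ} (hk1 : 1 ≤ k) (hkn : k ≤ n)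
    (lam : Fin n → ℝ) (hlam : lam ∈ Gamma n k) (hord : Antitone lam) :
    (0 < ∑ i ∈ Finset.univ.filter (fun i : Fin n => k - 1 ≤ (i : ℕ)), lam i) ∧
    ∀ i : Fin n, k ≤ (i : ℕ) → |lam i| ≤ (n : ℝ) * lam ⟨k - 1, by omega⟩ := by
  set A := Finset.univ.filter (fun i : Fin n => k - 1 ≤ (i : ℕ)) with hA
  have hcard : #Aᶜ = k - 1 := by
    have hcompl : Aᶜ = Finset.univ.filter (fun i : Fin n => (i : ℕ) < k - 1) := by
      ext i; simp [hA, Nat.lt_sub_iff_add_lt]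
    rw [hcompl, Fin.card_filter_val_lt]
    omega
  have hsum : 0 < ∑ i ∈ A, lam i := by
    have h := Finset.esymm_pos_of_union (A := A) (B := Aᶜ) (k := 1) disjoint_compl_left lam
      (fun j hj => ?_) 1 le_rfl
    · simpa [Finset.powersetCard_one] using h
    · rw [Finset.union_comm, Finset.union_compl]
      rcases Nat.eq_zero_or_pos j with rfl | hj0
      · simp
      · simpa [esigma] using hlam j hj0 (by omega)
  refine ⟨hsum, fun i hi => ?_⟩
  set M := lam ⟨k - 1, by omega⟩
  have hle : ∀ j ∈ A, lam j ≤ M := fun j hj => hord (Finset.mem_filter.1 hj).2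
  have hcardA : (#A : ℝ) ≤ n := by
    exact_mod_cast (Finset.card_le_univ A).trans_eq (Fintype.card_fin n)
  have hM : 0 < M := by
    have h := hsum.trans_le (Finset.sum_le_card_nsmul A lam M hle)
    rw [nsmul_eq_mul] at h
    exact pos_of_mul_pos_right h (Nat.cast_nonneg _)
  have hiA : i ∈ A := Finset.mem_filter.2 ⟨Finset.mem_univ i, by omega⟩
  have hn : (1 : ℝ) ≤ n := by exact_mod_cast hk1.trans hkn
  rw [abs_le]
  constructor
  · rw [← Finset.add_sum_erase A lam hiA] at hsum
    have h := Finset.sum_le_card_nsmul (A.erase i) lam M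
      fun j hj => hle j (Finset.mem_of_mem_erase hj)
    rw [nsmul_eq_mul] at h
    have herase : (#(A.erase i) : ℝ) ≤ n :=
      le_trans (by exact_mod_cast Finset.card_erase_le) hcardA
    have := mul_le_mul_of_nonneg_right herase hM.le
    linarith
  · exact (hle i hiA).trans (le_mul_of_one_le_left hM.le hn)
end
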